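/- Let m, n be integers with 0 ≤ 2m ≤ n. Then h_n(m, 2m) ≤ C(n, m) − C(n, m−1): there exists a cutset of B_n(m, 2m) which is a union of C(n,m) − C(n,m−1) saturated chains (hence of width at most C(n,m) − C(n,m−1)). -/

import Mathlib

open Finset
open scoped Classical

/-- The truncated Boolean lattice `B_n(m,l)`: subsets of `[n] = {1,...,n}`
of size at least `m` and at most `l`. -/
def truncBool (n m l : ℕ) : Finset (Finset ℕ) :=
  (Finset.Icc 1 n).powerset.filter (fun A => m ≤ A.card ∧ A.card ≤ l)

/-- `C` is a cutset of `B_n(m,l)`: it is contained in `B_n(m,l)` and meets every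
saturated (maximal) chain `A_m ⊂ A_{m+1} ⊂ ⋯ ⊂ A_l` with `|A_i| = i`. -/
def IsCutset (n m l : ℕ) (C : Finset (Finset ℕ)) : Prop :=
  C ⊆ truncBool n m l ∧
  ∀ f : ℕ → Finset ℕ,
    (∀ i, m ≤ i → i ≤ l → f i ⊆ Finset.Icc 1 n ∧ (f i).card = i) →
    (∀ i, m ≤ i → i < l → f i ⊆ f (i + 1)) →
    ∃ i, m ≤ i ∧ i ≤ l ∧ f i ∈ C

/-- The width of a family of sets: the maximum size of an antichain contained in it. -/
noncomputable def widthF (C : Finset (Finset ℕ)) : ℕ :=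
  (C.powerset.filter (fun S : Finset (Finset ℕ) => IsAntichain (· ⊆ ·) (S : Set (Finset ℕ)))).sup
    Finset.card

/-- `hFun n m l` is the minimum width of a cutset in `B_n(m,l)`. -/
noncomputable def hFun (n m l : ℕ) : ℕ :=
  sInf {w | ∃ C : Finset (Finset ℕ), IsCutset n m l C ∧ widthF C = w}

/-- Binomial coefficient with the convention `C n k = 0` for `k < 0`. -/
def binom (n : ℕ) (k : ℤ) : ℕ := if k < 0 then 0 else n.choose k.toNat

/-- `ch` is a saturated chain (of subsets): totally ordered by inclusion, and its
sizes form an interval of integers. -/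
def IsSatChain (ch : Finset (Finset ℕ)) : Prop :=
  (∀ A ∈ ch, ∀ B ∈ ch, A ⊆ B ∨ B ⊆ A) ∧
  (∀ A ∈ ch, ∀ B ∈ ch, ∀ k : ℕ, A.card ≤ k → k ≤ B.card → ∃ D ∈ ch, D.card = k)


/-- Number of elements of `X` that are at most `k`. -/
def cnt (X : Finset ℕ) (k : ℕ) : ℕ := (X.filter (fun x => x ≤ k)).card

/-- The level `j` of the cutset: sets of size `m + j` whose first `m` elements have
exactly `j` unmatched closing brackets. -/
def Lev (n m j : ℕ) (X : Finset ℕ) : Prop :=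
  X ⊆ Finset.Icc 1 n ∧ X.card = m + j ∧ (∀ k, 2 * min (cnt X k) m ≤ k + j) ∧
    ∃ k, 2 * min (cnt X k) m = k + j

lemma cnt_mono {X Y : Finset ℕ} (h : X ⊆ Y) (k : ℕ) : cnt X k ≤ cnt Y k :=
  Finset.card_le_card (Finset.filter_subset_filter _ h)

lemma cnt_le {X : Finset ℕ} {n : ℕ} (h : X ⊆ Finset.Icc 1 n) (k : ℕ) : cnt X k ≤ k := by
  have : X.filter (fun x => x ≤ k) ⊆ Finset.Icc 1 k := by
    intro x hx
    rw [Finset.mem_filter] at hx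
    have := Finset.mem_Icc.1 (h hx.1)
    exact Finset.mem_Icc.2 ⟨this.1, hx.2⟩
  simpa [cnt] using Finset.card_le_card this

lemma cnt_le_card (X : Finset ℕ) (k : ℕ) : cnt X k ≤ X.card :=
  Finset.card_le_card (Finset.filter_subset _ _)

lemma cnt_succ (X : Finset ℕ) (k : ℕ) :
    cnt X (k + 1) = cnt X k + if k + 1 ∈ X then 1 else 0 := by
  unfold cnt
  split_ifs with h
  · have : X.filter (fun x => x ≤ k + 1) = insert (k + 1) (X.filter (fun x => x ≤ k)) := by
      ext x
      simp only [Finset.mem_filter, Finset.mem_insert]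
      constructor
      · rintro ⟨a, b⟩
        by_cases hx : x = k + 1
        · exact Or.inl hx
        · exact Or.inr ⟨a, by omega⟩
      · rintro (rfl | ⟨a, b⟩)
        · exact ⟨h, le_rfl⟩
        · exact ⟨a, by omega⟩
    rw [this, Finset.card_insert_of_notMem]
    simp
  · congr 1
    ext x
    simp only [Finset.mem_filter]
    constructor
    · rintro ⟨a, b⟩
      refine ⟨a, ?_⟩
      have : x ≠ k + 1 := by rintro rfl; exact h a
      omega
    · rintro ⟨a, b⟩
      exact ⟨a, by omega⟩

lemma cnt_erase {X : Finset ℕ} {y : ℕ} (hy : y ∈ X) (k : ℕ) :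
    cnt X k = cnt (X.erase y) k + if y ≤ k then 1 else 0 := by
  unfold cnt
  rw [Finset.filter_erase]
  split_ifs with h
  · rw [Finset.card_erase_add_one]
    simp [hy, h]
  · rw [Finset.erase_eq_of_notMem]
    · simp
    · simp [h]

/-- The pivot: first place where the maximum is attained. -/
lemma exists_pivot {n m j : ℕ} {X : Finset ℕ} (h : Lev n m (j + 1) X) :
    ∃ y, y + 1 ∈ X ∧ cnt X y < m ∧ 2 * cnt X y = y + j ∧ Lev n m j (X.erase (y + 1)) := by
  obtain ⟨hX, hc, hle, hex⟩ := h
  have hs := Nat.find_spec hex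
  have hmin : ∀ k, k < Nat.find hex → 2 * min (cnt X k) m ≠ k + (j + 1) :=
    fun k hk => Nat.find_min hex hk
  generalize Nat.find hex = k at hs hmin
  obtain _ | y := k
  · have := cnt_le hX 0
    omega
  have h1 := hmin y (by omega)
  have h2 := hle y
  have h3 := cnt_succ X y
  have hmem : y + 1 ∈ X := by
    by_contra hn
    rw [if_neg hn] at h3
    rw [h3] at hs
    omega
  rw [if_pos hmem] at h3
  have hlt : cnt X y < m := by
    by_contra hn
    omega
  have heq : 2 * cnt X y = y + j := by omega
  refine ⟨y, hmem, hlt, heq, (Finset.erase_subset _ _).trans hX, ?_, ?_, y, ?_⟩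
  · rw [Finset.card_erase_of_mem hmem]
    omega
  · intro i
    have he := cnt_erase hmem i
    have hi := hle i
    split_ifs at he with hyi
    · by_cases hm : cnt X i ≤ m
      · omega
      · obtain _ | i' := i
        · omega
        have h5 := cnt_succ X i'
        have h6 := hle i'
        split_ifs at h5 <;> omega
    · have := hmin i (by omega)
      omega
  · have he := cnt_erase hmem y
    rw [if_neg (by omega)] at he
    omega

/-- One step down. -/
noncomputable def dn (n m : ℕ) (X : Finset ℕ) : Finset ℕ :=
  if h : ∃ y j, y + 1 ∈ X ∧ cnt X y < m ∧ 2 * cnt X y = y + j ∧ Lev n m (j + 1) X ∧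
    Lev n m j (X.erase (y + 1)) then X.erase (h.choose + 1) else X

lemma dn_spec {n m j : ℕ} {X : Finset ℕ} (h : Lev n m (j + 1) X) :
    ∃ y, y + 1 ∈ X ∧ cnt X y < m ∧ 2 * cnt X y = y + j ∧ Lev n m j (X.erase (y + 1)) ∧
      dn n m X = X.erase (y + 1) := by
  have hex : ∃ y j, y + 1 ∈ X ∧ cnt X y < m ∧ 2 * cnt X y = y + j ∧ Lev n m (j + 1) X ∧
    Lev n m j (X.erase (y + 1)) := by
    obtain ⟨y, a, b, c, d⟩ := exists_pivot h
    exact ⟨y, j, a, b, c, h, d⟩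
  have hd : dn n m X = X.erase (hex.choose + 1) := by
    unfold dn
    rw [dif_pos hex]
  obtain ⟨j', a, b, c, d, e⟩ := hex.choose_spec
  have : j' = j := by
    have h1 := h.2.1
    have h2 := d.2.1
    omega
  subst this
  exact ⟨_, a, b, c, e, hd⟩

lemma dn_inj_aux {n m j : ℕ} {X X' : Finset ℕ} {y y' : ℕ} (h : Lev n m (j + 1) X)
    (hy : y + 1 ∈ X) (hy' : y' + 1 ∈ X')
    (hlt' : cnt X' y' < m) (he' : 2 * cnt X' y' = y' + j)
    (hE : X.erase (y + 1) = X'.erase (y' + 1)) (hyy : y < y') : False := by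
  have h1 := cnt_erase hy y'
  have h2 := cnt_erase hy' y'
  rw [if_pos (by omega), hE] at h1
  rw [if_neg (by omega)] at h2
  have h3 := h.2.2.1 y'
  omega

lemma dn_inj {n m j : ℕ} {X X' : Finset ℕ} (h : Lev n m (j + 1) X) (h' : Lev n m (j + 1) X')
    (hE : dn n m X = dn n m X') : X = X' := by
  obtain ⟨y, a, b, c, d, e⟩ := dn_spec h
  obtain ⟨y', a', b', c', d', e'⟩ := dn_spec h'
  rw [e, e'] at hE
  rcases lt_trichotomy y y' with hl | hl | hl
  · exact (dn_inj_aux h a a' b' c' hE hl).elim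
  · subst hl
    rw [← Finset.insert_erase a, hE, Finset.insert_erase a']
  · exact (dn_inj_aux h' a' a b c hE.symm hl).elim

lemma dn_lev {n m j : ℕ} {X : Finset ℕ} (h : Lev n m (j + 1) X) : Lev n m j (dn n m X) := by
  obtain ⟨y, a, b, c, d, e⟩ := dn_spec h
  rwa [e]

lemma dn_sub {n m j : ℕ} {X : Finset ℕ} (h : Lev n m (j + 1) X) : dn n m X ⊆ X := by
  obtain ⟨y, a, b, c, d, e⟩ := dn_spec h
  rw [e]
  exact Finset.erase_subset _ _

lemma iter_lev {n m : ℕ} (i : ℕ) : ∀ {j : ℕ} {X : Finset ℕ}, Lev n m (j + i) X →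
    Lev n m j ((dn n m)^[i] X) ∧ (dn n m)^[i] X ⊆ X := by
  induction i with
  | zero => intro j X h; exact ⟨h, subset_rfl⟩
  | succ i ih =>
    intro j X h
    have h1 : Lev n m (j + i) (dn n m X) := dn_lev h
    have := ih h1
    rw [Function.iterate_succ_apply]
    exact ⟨this.1, this.2.trans (dn_sub (j := j + i) h)⟩

lemma iter_inj {n m : ℕ} (i : ℕ) : ∀ {X X' : Finset ℕ}, Lev n m i X → Lev n m i X' →
    (dn n m)^[i] X = (dn n m)^[i] X' → X = X' := by
  induction i with
  | zero => intro X X' _ _ h; exact h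
  | succ i ih =>
    intro X X' h h' hE
    rw [Function.iterate_succ_apply, Function.iterate_succ_apply] at hE
    exact dn_inj h h' (ih (dn_lev h) (dn_lev h') hE)

/-- The bottom of the chain through `X`. -/
noncomputable def base (n m : ℕ) (X : Finset ℕ) : Finset ℕ := (dn n m)^[X.card - m] X

lemma base_eq {n m j : ℕ} {X : Finset ℕ} (h : Lev n m j X) :
    base n m X = (dn n m)^[j] X := by
  unfold base
  rw [h.2.1]
  simp

lemma base_comparable {n m i j : ℕ} {X X' : Finset ℕ} (h : Lev n m i X) (h' : Lev n m j X')
    (hij : i ≤ j) (hE : base n m X = base n m X') : X ⊆ X' := by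
  obtain ⟨d, rfl⟩ := Nat.exists_eq_add_of_le hij
  have h1 := iter_lev d h'
  rw [base_eq h, base_eq h', Function.iterate_add_apply] at hE
  have := iter_inj i h h1.1 hE
  rw [this]
  exact h1.2

/-- The maximum of the height function. -/
def hgt (m : ℕ) (X : Finset ℕ) : ℕ :=
  (Finset.range (2 * m + 1)).sup (fun k => 2 * min (cnt X k) m - k)

lemma hgt_mono {m : ℕ} {X Y : Finset ℕ} (h : X ⊆ Y) : hgt m X ≤ hgt m Y := by
  apply Finset.sup_mono_fun
  intro k _
  have := cnt_mono h k
  omega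

lemma hgt_le {n m : ℕ} {X : Finset ℕ} (h : X ⊆ Finset.Icc 1 n) : hgt m X ≤ m := by
  apply Finset.sup_le
  intro k _
  have := cnt_le h k
  omega

lemma lev_of_hgt {n m j : ℕ} {X : Finset ℕ} (h : X ⊆ Finset.Icc 1 n) (hc : X.card = m + j)
    (hh : hgt m X = j) : Lev n m j X := by
  refine ⟨h, hc, ?_, ?_⟩
  · intro k
    by_cases hk : k < 2 * m + 1
    · have : 2 * min (cnt X k) m - k ≤ hgt m X :=
        Finset.le_sup (f := fun k => 2 * min (cnt X k) m - k) (Finset.mem_range.2 hk)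
      omega
    · omega
  · obtain _ | j := j
    · refine ⟨0, ?_⟩
      have := cnt_le h 0
      omega
    · obtain ⟨k, hk, hk'⟩ := Finset.exists_mem_eq_sup (Finset.range (2 * m + 1)) ⟨0, by simp⟩
        (fun k => 2 * min (cnt X k) m - k)
      refine ⟨k, ?_⟩
      have : hgt m X = 2 * min (cnt X k) m - k := hk'
      omega

/-- Ballot sets. -/
noncomputable def bal (n m : ℕ) : Finset (Finset ℕ) :=
  ((Finset.Icc 1 n).powersetCard m).filter (fun X => ∀ k, k ≤ n → 2 * cnt X k ≤ k)

lemma cnt_top {X : Finset ℕ} {n : ℕ} (h : X ⊆ Finset.Icc 1 n) {k : ℕ} (hk : n ≤ k) :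
    cnt X k = X.card := by
  unfold cnt
  rw [Finset.filter_true_of_mem]
  intro x hx
  exact (Finset.mem_Icc.1 (h hx)).2.trans hk

lemma mem_bal {n m : ℕ} {X : Finset ℕ} : X ∈ bal n m ↔
    X ⊆ Finset.Icc 1 n ∧ X.card = m ∧ ∀ k, k ≤ n → 2 * cnt X k ≤ k := by
  simp [bal, Finset.mem_powersetCard, and_assoc]

lemma lev_zero_iff {n m : ℕ} (h : 2 * m ≤ n) {X : Finset ℕ} : Lev n m 0 X ↔ X ∈ bal n m := by
  rw [mem_bal]
  constructor
  · rintro ⟨a, b, c, d⟩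
    refine ⟨a, b, fun k _ => ?_⟩
    have := c k
    have := cnt_le_card X k
    omega
  · rintro ⟨a, b, c⟩
    refine ⟨a, b, fun k => ?_, 0, ?_⟩
    · by_cases hk : k ≤ n
      · have := c k hk
        omega
      · omega
    · have := cnt_le a 0
      omega

lemma bal_empty {n m : ℕ} (h : n < 2 * m) : bal n m = ∅ := by
  rw [Finset.eq_empty_iff_forall_notMem]
  intro X hX
  rw [mem_bal] at hX
  obtain ⟨a, b, c⟩ := hX
  have := c n le_rfl
  rw [cnt_top a le_rfl] at this
  omega

lemma bal_zero (n : ℕ) : (bal n 0).card = 1 := by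
  have : bal n 0 = {∅} := by
    ext X
    rw [mem_bal, Finset.mem_singleton]
    constructor
    · rintro ⟨_, b, _⟩
      exact Finset.card_eq_zero.1 b
    · rintro rfl
      simp [cnt]
  rw [this]
  simp

lemma bal_succ {n m : ℕ} (h : 2 * (m + 1) ≤ n + 1) :
    (bal (n + 1) (m + 1)).card = (bal n (m + 1)).card + (bal n m).card := by
  have hnot : ∀ X : Finset ℕ, X ⊆ Finset.Icc 1 n → n + 1 ∉ X := by
    intro X hX hn
    have := Finset.mem_Icc.1 (hX hn)
    omega
  have hins : ∀ X : Finset ℕ, X ⊆ Finset.Icc 1 n → ∀ k, k ≤ n →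
      cnt (insert (n + 1) X) k = cnt X k := by
    intro X hX k hk
    have := cnt_erase (Finset.mem_insert_self (n + 1) X) k
    rw [if_neg (by omega), Finset.erase_insert (hnot X hX)] at this
    exact this
  have hE : bal (n + 1) (m + 1) = bal n (m + 1) ∪ (bal n m).image (insert (n + 1)) := by
    ext X
    rw [Finset.mem_union, Finset.mem_image, mem_bal, mem_bal]
    constructor
    · rintro ⟨a, b, c⟩
      by_cases hn : n + 1 ∈ X
      · right
        have hs : X.erase (n + 1) ⊆ Finset.Icc 1 n := by
          intro x hx
          rw [Finset.mem_erase] at hx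
          have := Finset.mem_Icc.1 (a hx.2)
          exact Finset.mem_Icc.2 ⟨this.1, by omega⟩
        refine ⟨X.erase (n + 1), mem_bal.2 ⟨hs, ?_, ?_⟩, Finset.insert_erase hn⟩
        · rw [Finset.card_erase_of_mem hn, b]
          rfl
        · intro k hk
          rw [← hins _ hs k hk, Finset.insert_erase hn]
          exact c k (by omega)
      · left
        refine ⟨?_, b, fun k hk => c k (by omega)⟩
        intro x hx
        have := Finset.mem_Icc.1 (a hx)
        have hne : x ≠ n + 1 := by rintro rfl; exact hn hx
        exact Finset.mem_Icc.2 ⟨this.1, by omega⟩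
    · have hsub : Finset.Icc 1 n ⊆ Finset.Icc 1 (n + 1) :=
        Finset.Icc_subset_Icc_right (by omega)
      rintro (⟨a, b, c⟩ | ⟨Y, hY, rfl⟩)
      · refine ⟨a.trans hsub, b, fun k hk => ?_⟩
        by_cases hk' : k ≤ n
        · exact c k hk'
        · have := cnt_le_card X k
          omega
      · obtain ⟨a, b, c⟩ := mem_bal.1 hY
        have hcard : (insert (n + 1) Y).card = m + 1 := by
          rw [Finset.card_insert_of_notMem (hnot Y a), b]
        refine ⟨?_, hcard, fun k hk => ?_⟩
        · intro x hx
          rcases Finset.mem_insert.1 hx with rfl | hx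
          · exact Finset.mem_Icc.2 ⟨by omega, le_rfl⟩
          · exact hsub (a hx)
        · by_cases hk' : k ≤ n
          · rw [hins Y a k hk']
            exact c k hk'
          · have := cnt_le_card (insert (n + 1) Y) k
            omega
  rw [hE, Finset.card_union_of_disjoint, Finset.card_image_of_injOn]
  · intro X hX Y hY hXY
    have h1 := hnot X (mem_bal.1 hX).1
    have h2 := hnot Y (mem_bal.1 hY).1
    have h3 : insert (n + 1) X = insert (n + 1) Y := hXY
    rw [← Finset.erase_insert h1, h3, Finset.erase_insert h2]
  · rw [Finset.disjoint_left]
    intro X hX hX'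
    obtain ⟨Y, _, rfl⟩ := Finset.mem_image.1 hX'
    exact hnot _ (mem_bal.1 hX).1 (Finset.mem_insert_self _ _)

lemma bal_card (n : ℕ) : ∀ m, 2 * (m + 1) ≤ n + 1 →
    (bal n (m + 1)).card + n.choose m = n.choose (m + 1) := by
  induction n with
  | zero => intro m h; omega
  | succ n ih =>
    intro m h
    by_cases he : 2 * (m + 1) = n + 1 + 1
    · rw [bal_empty (by omega)]
      have : n + 1 = 2 * m + 1 := by omega
      rw [this, Finset.card_empty, zero_add]
      exact (Nat.choose_symm_half m).symm
    · rw [bal_succ (by omega)]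
      have h1 := ih m (by omega)
      obtain _ | m := m
      · rw [bal_zero]
        simp at h1 ⊢
        omega
      · have h2 := ih m (by omega)
        have e1 := Nat.choose_succ_succ n (m + 1)
        have e2 := Nat.choose_succ_succ n m
        simp only [Nat.succ_eq_add_one] at e1 e2
        omega

lemma bal_card' {n m : ℕ} (h : 2 * m ≤ n) :
    (bal n m).card = n.choose m - binom n ((m : ℤ) - 1) := by
  obtain _ | m := m
  · rw [bal_zero]
    simp [binom]
  · have := bal_card n m (by omega)
    have hb : binom n (((m + 1 : ℕ) : ℤ) - 1) = n.choose m := by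
      simp [binom]
    rw [hb]
    omega

theorem stmt_18 (n m : ℕ) (h : 2 * m ≤ n) :
    ∃ C : Finset (Finset ℕ), IsCutset n m (2 * m) C ∧
      (∃ 𝒞 : Finset (Finset (Finset ℕ)),
        𝒞.card = n.choose m - binom n ((m : ℤ) - 1) ∧
        (∀ ch ∈ 𝒞, IsSatChain ch) ∧
        C = 𝒞.sup id) ∧
      widthF C ≤ n.choose m - binom n ((m : ℤ) - 1) := by
  rw [← bal_card' h]
  have hcov : ∀ X, X ∈ (truncBool n m (2 * m)).filter (fun X => ∃ j, Lev n m j X) ↔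
      ∃ j, j ≤ m ∧ Lev n m j X := by
    intro X
    rw [Finset.mem_filter, truncBool, Finset.mem_filter, Finset.mem_powerset]
    constructor
    · rintro ⟨⟨_, _, b⟩, j, hj⟩
      have := hj.2.1
      exact ⟨j, by omega, hj⟩
    · rintro ⟨j, hj, hL⟩
      have := hL.2.1
      exact ⟨⟨hL.1, by omega, by omega⟩, j, hL⟩
  set C := (truncBool n m (2 * m)).filter (fun X => ∃ j, Lev n m j X) with hC
  have hcomp : ∀ X ∈ C, ∀ Y ∈ C, base n m X = base n m Y → X ⊆ Y ∨ Y ⊆ X := by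
    intro X hX Y hY hE
    obtain ⟨i, _, hi⟩ := (hcov X).1 hX
    obtain ⟨j, _, hj⟩ := (hcov Y).1 hY
    rcases le_total i j with hij | hij
    · exact Or.inl (base_comparable hi hj hij hE)
    · exact Or.inr (base_comparable hj hi hij hE.symm)
  have hbase : ∀ X ∈ C, base n m X ∈ bal n m := by
    intro X hX
    obtain ⟨i, _, hi⟩ := (hcov X).1 hX
    rw [base_eq hi, ← lev_zero_iff h]
    exact (iter_lev (j := 0) i (by simpa using hi)).1
  have hbot : ∀ A ∈ bal n m, A ∈ C ∧ base n m A = A := by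
    intro A hA
    have hL := (lev_zero_iff h).2 hA
    exact ⟨(hcov A).2 ⟨0, by omega, hL⟩, by rw [base_eq hL]; rfl⟩
  refine ⟨C, ⟨Finset.filter_subset _ _, ?_⟩,
    ⟨(bal n m).image (fun A => C.filter (fun X => base n m X = A)), ?_, ?_, ?_⟩, ?_⟩
  · intro f hf hmono
    have hex : ∃ j, j ≤ m ∧ hgt m (f (m + j)) ≤ j :=
      ⟨m, le_rfl, hgt_le (hf (m + m) (by omega) (by omega)).1⟩
    obtain ⟨hj, hle⟩ := Nat.find_spec hex
    have hmin : ∀ i, i < Nat.find hex → ¬ (i ≤ m ∧ hgt m (f (m + i)) ≤ i) :=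
      fun i hi => Nat.find_min hex hi
    generalize Nat.find hex = j at hj hle hmin
    have hfj := hf (m + j) (by omega) (by omega)
    have heq : hgt m (f (m + j)) = j := by
      obtain _ | j := j
      · omega
      · have h1 := hmin j (by omega)
        have h2 := hgt_mono (m := m) (hmono (m + j) (by omega) (by omega))
        have h3 : m + (j + 1) = m + j + 1 := by omega
        rw [h3] at hle ⊢
        have h4 : ¬ hgt m (f (m + j)) ≤ j := fun hh => h1 ⟨by omega, hh⟩
        omega
    exact ⟨m + j, by omega, by omega, (hcov _).2 ⟨j, hj, lev_of_hgt hfj.1 hfj.2 heq⟩⟩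
  · rw [Finset.card_image_of_injOn]
    intro A hA B hB hAB
    have h1 := hbot A hA
    have h2 : A ∈ C.filter (fun X => base n m X = A) := Finset.mem_filter.2 h1
    have h3 : C.filter (fun X => base n m X = A) = C.filter (fun X => base n m X = B) := hAB
    rw [h3, Finset.mem_filter] at h2
    exact h1.2.symm.trans h2.2
  · intro ch hch
    obtain ⟨A, hA, rfl⟩ := Finset.mem_image.1 hch
    refine ⟨?_, ?_⟩
    · intro X hX Y hY
      rw [Finset.mem_filter] at hX hY
      exact hcomp X hX.1 Y hY.1 (hX.2.trans hY.2.symm)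
    · intro X hX Y hY k hk1 hk2
      rw [Finset.mem_filter] at hX hY
      obtain ⟨i, _, hi⟩ := (hcov X).1 hX.1
      obtain ⟨j, hjm, hj⟩ := (hcov Y).1 hY.1
      have e1 := hi.2.1
      have e2 := hj.2.1
      obtain ⟨l, rfl⟩ := Nat.exists_eq_add_of_le (show m ≤ k by omega)
      obtain ⟨d, rfl⟩ := Nat.exists_eq_add_of_le (show l ≤ j by omega)
      have h1 := (iter_lev d hj).1
      refine ⟨(dn n m)^[d] Y, Finset.mem_filter.2 ⟨(hcov _).2 ⟨l, by omega, h1⟩, ?_⟩, h1.2.1⟩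
      rw [base_eq h1, ← Function.iterate_add_apply, ← base_eq hj]
      exact hY.2
  · ext X
    rw [Finset.mem_sup]
    constructor
    · intro hX
      exact ⟨_, Finset.mem_image.2 ⟨base n m X, hbase X hX, rfl⟩,
        Finset.mem_filter.2 ⟨hX, rfl⟩⟩
    · rintro ⟨ch, hch, hX⟩
      obtain ⟨A, hA, rfl⟩ := Finset.mem_image.1 hch
      exact (Finset.mem_filter.1 hX).1
  · apply Finset.sup_le
    intro S hS
    rw [Finset.mem_filter, Finset.mem_powerset] at hS
    obtain ⟨hSC, hanti⟩ := hS
    apply Finset.card_le_card_of_injOn (base n m)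
    · intro X hX
      exact hbase X (hSC hX)
    · intro X hX Y hY hE
      by_contra hne
      rcases hcomp X (hSC hX) Y (hSC hY) hE with hh | hh
      · exact hanti hX hY hne hh
      · exact hanti hY hX (Ne.symm hne) hh
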